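/- arXiv:1612.08269 — 3 statements merged into one kernel-verified Lean document; each statement's English description precedes it below -/
import Mathlib

section
/- Let K ≥ 2 be an integer and let Q(K) be the set of positive integers q such that p^(v_p(q)) ≤ K for every prime p. Then there exists an integer n ≥ 3 such that for every r ∈ Q(K): r divides n−2 if and only if r divides 2; r divides n−1 if and only if r = 1; r divides n if and only if r divides 60; r divides n+1 if and only if r = 1; and r divides n+2 if and only if r divides 2. -/
/-- `QSet K` is the set of positive integers `q` such that `p ^ (v_p q) ≤ K`
for every prime `p`. -/
def QSet (K : ℕ) : Set ℕ :=
  {q | 0 < q ∧ ∀ p : ℕ, Nat.Prime p → p ^ (Nat.factorization q p) ≤ K}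

lemma le_of_prime_dvd_of_mem_QSet {K r p : ℕ} (hr : r ∈ QSet K) (hp : p.Prime) (h : p ∣ r) :
    p ≤ K :=
  (Nat.le_self_pow (hp.factorization_pos_of_dvd hr.1.ne' h).ne' p).trans (hr.2 p hp)

/-- A factor without prime divisors up to `K` does not affect divisibility by members of
`QSet K`. -/
lemma dvd_mul_iff_of_mem_QSet {K r c m : ℕ} (hr : r ∈ QSet K)
    (hm : ∀ p : ℕ, p.Prime → p ≤ K → ¬ p ∣ m) : r ∣ c * m ↔ r ∣ c := by
  refine Nat.Coprime.dvd_mul_right (Nat.coprime_of_dvd fun p hp hpr hpm => ?_)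
  exact hm p hp (le_of_prime_dvd_of_mem_QSet hr hp hpr) hpm

lemma exists_forall_prime_dvd (K : ℕ) :
    ∃ t : ℕ, ∀ p : ℕ, p.Prime → 7 ≤ p → p ≤ K → p ∣ 57 + 3600 * t := by
  set M := ∏ p ∈ (Finset.Icc 7 K).filter Nat.Prime, p with hM
  have hcop : Nat.Coprime 3600 M := by
    refine Nat.Coprime.prod_right fun p hp => ?_
    obtain ⟨hp7, hp⟩ := Finset.mem_filter.1 hp
    have h7 := (Finset.mem_Icc.1 hp7).1
    refine ((Nat.Prime.coprime_iff_not_dvd hp).2 fun h => ?_).symm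
    have h30 : p ∣ 30 := by
      refine hp.dvd_of_dvd_pow (n := 4) (h.trans ?_)
      norm_num
    have hle := Nat.le_of_dvd (by norm_num) h30
    interval_cases p <;> revert hp h30 <;> norm_num
  obtain ⟨n, h1, h2⟩ := Nat.chineseRemainder hcop 60 3
  have hn : n % 3600 = 60 := h1
  refine ⟨n / 3600, fun p hp h7 hK => ?_⟩
  have hpM : p ∣ M :=
    Finset.dvd_prod_of_mem _ (Finset.mem_filter.2 ⟨Finset.mem_Icc.2 ⟨h7, hK⟩, hp⟩)
  have h3 : p ∣ n - 3 := (Nat.modEq_iff_dvd' (by omega)).1 (h2.of_dvd hpM).symm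
  have he : 57 + 3600 * (n / 3600) = n - 3 := by omega
  rwa [he]

theorem stmt_1 (K : ℕ) (hK : 2 ≤ K) :
    ∃ n : ℕ, 3 ≤ n ∧ ∀ r ∈ QSet K,
      (r ∣ n - 2 ↔ r ∣ 2) ∧ (r ∣ n - 1 ↔ r = 1) ∧ (r ∣ n ↔ r ∣ 60) ∧
        (r ∣ n + 1 ↔ r = 1) ∧ (r ∣ n + 2 ↔ r ∣ 2) := by
  obtain ⟨t, ht⟩ := exists_forall_prime_dvd K
  have key : ∀ m a c : ℕ, 0 < a → a < 7 → c * m = 57 + 3600 * t + a →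
      ¬ 2 ∣ m → ¬ 3 ∣ m → ¬ 5 ∣ m → ∀ p : ℕ, p.Prime → p ≤ K → ¬ p ∣ m := by
    intro m a c ha ha7 hm h2 h3 h5 p hp hpK hpm
    rcases lt_or_ge p 7 with h | h
    · interval_cases p <;> contradiction
    · have hd : p ∣ 57 + 3600 * t + a := hm ▸ hpm.mul_left c
      have := Nat.le_of_dvd ha ((Nat.dvd_add_right (ht p hp h hpK)).1 hd)
      omega
  refine ⟨60 + 3600 * t, by omega, fun r hr => ⟨?_, ?_, ?_, ?_, ?_⟩⟩
  · rw [show 60 + 3600 * t - 2 = 2 * (29 + 1800 * t) by omega]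
    exact dvd_mul_iff_of_mem_QSet hr
      (key _ 1 2 (by omega) (by omega) (by omega) (by omega) (by omega) (by omega))
  · rw [show 60 + 3600 * t - 1 = 1 * (59 + 3600 * t) by omega, ← Nat.dvd_one]
    exact dvd_mul_iff_of_mem_QSet hr
      (key _ 2 1 (by omega) (by omega) (by omega) (by omega) (by omega) (by omega))
  · rw [show 60 + 3600 * t = 60 * (1 + 60 * t) by omega]
    exact dvd_mul_iff_of_mem_QSet hr
      (key _ 3 60 (by omega) (by omega) (by omega) (by omega) (by omega) (by omega))
  · rw [show 60 + 3600 * t + 1 = 1 * (61 + 3600 * t) by omega, ← Nat.dvd_one]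
    exact dvd_mul_iff_of_mem_QSet hr
      (key _ 4 1 (by omega) (by omega) (by omega) (by omega) (by omega) (by omega))
  · rw [show 60 + 3600 * t + 2 = 2 * (31 + 1800 * t) by omega]
    exact dvd_mul_iff_of_mem_QSet hr
      (key _ 5 2 (by omega) (by omega) (by omega) (by omega) (by omega) (by omega))
end

section
/- Let K ≥ 2 be an integer and let Q(K) be the set of positive integers q such that p^(v_p(q)) ≤ K for every prime p. Let q ∈ Q(K) be coprime to 2 and to 3. Then there exists an integer n ≥ 4 such that for every r ∈ Q(K): r divides n−3 if and only if r divides 2; r divides n−2 if and only if r = 1; 6 divides n−1; r divides n if and only if r divides q; and r divides n+1 if and only if r divides 2. -/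
theorem le_of_prime_of_dvd_of_mem_QSet {K r p : ℕ} (hr : r ∈ QSet K) (hp : p.Prime) (hpr : p ∣ r) :
    p ≤ K := by
  have hv : 1 ≤ r.factorization p := (hp.dvd_iff_one_le_factorization hr.1.ne').1 hpr
  calc p = p ^ 1 := (pow_one p).symm
    _ ≤ p ^ r.factorization p := Nat.pow_le_pow_right hp.pos hv
    _ ≤ K := hr.2 p hp

theorem exists_coprime_multiple_of_primes (K q : ℕ) (hq2 : Nat.Coprime q 2)
    (hq3 : Nat.Coprime q 3) :
    ∃ A : ℕ, 0 < A ∧ 12 ∣ A ∧ Nat.Coprime A q ∧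
      ∀ p : ℕ, p.Prime → p ≤ K → ¬ p ∣ q → p ∣ A := by
  let S := (Finset.range (K + 1)).filter fun p => p.Prime ∧ ¬ p ∣ q
  have hS : ∀ p ∈ S, p.Prime ∧ ¬ p ∣ q := fun p hp => (Finset.mem_filter.1 hp).2
  refine ⟨12 * ∏ p ∈ S, p, ?_, dvd_mul_right _ _, ?_, ?_⟩
  · exact Nat.mul_pos (by norm_num) (Finset.prod_pos fun p hp => (hS p hp).1.pos)
  · refine Nat.Coprime.mul_left ?_ (Nat.Coprime.prod_left fun p hp =>
      (hS p hp).1.coprime_iff_not_dvd.2 (hS p hp).2)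
    exact ((hq2.mul_right hq2).mul_right hq3).symm
  · intro p hp hpK hpq
    exact dvd_mul_of_dvd_right (Finset.dvd_prod_of_mem (fun p => p)
      (Finset.mem_filter.2 ⟨Finset.mem_range.2 (by omega), hp, hpq⟩)) _

theorem exists_one_mod_and_eq_mul_one_add {A q : ℕ} (hA : 12 ≤ A) (hq : 0 < q)
    (h : Nat.Coprime A q) :
    ∃ n t : ℕ, 4 ≤ n ∧ A ∣ n - 1 ∧ n = q * (1 + q * t) := by
  obtain ⟨m, hm1, hm2⟩ := Nat.chineseRemainder (h.pow_right 2) 1 q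
  have hqq : q ≤ q ^ 2 := Nat.le_self_pow (by norm_num) q
  have hle : 12 * q ^ 2 ≤ A * q ^ 2 := Nat.mul_le_mul_right _ hA
  have h1 : 1 ≡ m + A * q ^ 2 [MOD A] := by
    simpa [Nat.ModEq] using hm1.symm
  have h2 : q ≡ m + A * q ^ 2 [MOD q ^ 2] := by
    simpa [Nat.ModEq] using hm2.symm
  obtain ⟨t, ht⟩ := (Nat.modEq_iff_dvd' (by omega)).1 h2
  refine ⟨m + A * q ^ 2, t, by omega, (Nat.modEq_iff_dvd' (by omega)).1 h1, ?_⟩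
  have : m + A * q ^ 2 = q + q ^ 2 * t := by omega
  rw [this]
  ring

theorem dvd_two_iff_of_mod_four {r m : ℕ} (hm : m % 4 = 2)
    (h : ∀ p : ℕ, p.Prime → p ∣ r → p ∣ m → p = 2) : r ∣ m ↔ r ∣ 2 := by
  obtain ⟨k, rfl⟩ : 2 ∣ m := by omega
  refine ⟨fun hr => ?_, fun hr => hr.mul_right k⟩
  refine Nat.Coprime.dvd_of_dvd_mul_right (Nat.coprime_of_dvd fun p hp hpr hpk => ?_) hr
  obtain rfl := h p hp hpr (hpk.mul_left 2)
  omega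

theorem stmt_2 (K : ℕ) (hK : 2 ≤ K) (q : ℕ) (hq : q ∈ QSet K)
    (hq2 : Nat.Coprime q 2) (hq3 : Nat.Coprime q 3) :
    ∃ n : ℕ, 4 ≤ n ∧ 6 ∣ n - 1 ∧ ∀ r ∈ QSet K,
      (r ∣ n - 3 ↔ r ∣ 2) ∧ (r ∣ n - 2 ↔ r = 1) ∧ (r ∣ n ↔ r ∣ q) ∧
        (r ∣ n + 1 ↔ r ∣ 2) := by
  obtain ⟨A, hA, h12, hAq, hpA⟩ := exists_coprime_multiple_of_primes K q hq2 hq3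
  obtain ⟨n, t, hn4, hAn, hnt⟩ :=
    exists_one_mod_and_eq_mul_one_add (Nat.le_of_dvd hA h12) hq.1 hAq
  have h12n : 12 ∣ n - 1 := h12.trans hAn
  have hqn : q ∣ n := ⟨_, hnt⟩
  have hpn : ∀ p r : ℕ, r ∈ QSet K → p.Prime → p ∣ r → ¬ p ∣ q → p ∣ n - 1 :=
    fun p r hr hp hpr hpq => (hpA p hp (le_of_prime_of_dvd_of_mem_QSet hr hp hpr) hpq).trans hAn
  have not_two : ¬ 2 ∣ q := (Nat.prime_two.coprime_iff_not_dvd).1 hq2.symm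
  have not_three : ¬ 3 ∣ q := (Nat.prime_three.coprime_iff_not_dvd).1 hq3.symm
  refine ⟨n, hn4, by omega, fun r hr => ⟨?_, ?_, ?_, ?_⟩⟩
  · refine dvd_two_iff_of_mod_four (by omega) fun p hp hpr hpm => ?_
    by_cases hpq : p ∣ q
    · have h3 : p ∣ 3 := by
        have := Nat.dvd_sub (hpq.trans hqn) hpm
        rwa [show n - (n - 3) = 3 by omega] at this
      rw [(Nat.prime_dvd_prime_iff_eq hp Nat.prime_three).1 h3] at hpq
      exact absurd hpq not_three
    · have := Nat.dvd_sub (hpn p r hr hp hpr hpq) hpm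
      rw [show n - 1 - (n - 3) = 2 by omega] at this
      exact (Nat.prime_dvd_prime_iff_eq hp Nat.prime_two).1 this
  · refine ⟨fun hrn => ?_, fun h => h ▸ one_dvd _⟩
    by_contra hr1
    obtain ⟨p, hp, hpr⟩ := Nat.exists_prime_and_dvd hr1
    have hpm := hpr.trans hrn
    by_cases hpq : p ∣ q
    · have := Nat.dvd_sub (hpq.trans hqn) hpm
      rw [show n - (n - 2) = 2 by omega] at this
      rw [(Nat.prime_dvd_prime_iff_eq hp Nat.prime_two).1 this] at hpq
      exact not_two hpq
    · have := Nat.dvd_sub (hpn p r hr hp hpr hpq) hpm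
      rw [show n - 1 - (n - 2) = 1 by omega] at this
      exact hp.one_lt.ne' (Nat.dvd_one.1 this)
  · refine ⟨fun hrn => ?_, fun h => h.trans hqn⟩
    refine Nat.Coprime.dvd_of_dvd_mul_right ?_ (hnt ▸ hrn)
    refine Nat.coprime_of_dvd fun p hp hpr hpt => ?_
    by_cases hpq : p ∣ q
    · exact hp.one_lt.ne' (Nat.dvd_one.1 ((Nat.dvd_add_left (hpq.mul_right t)).1 hpt))
    · have := Nat.dvd_sub (hpr.trans hrn) (hpn p r hr hp hpr hpq)
      rw [show n - (n - 1) = 1 by omega] at this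
      exact hp.one_lt.ne' (Nat.dvd_one.1 this)
  · refine dvd_two_iff_of_mod_four (by omega) fun p hp hpr hpm => ?_
    by_cases hpq : p ∣ q
    · exact absurd (Nat.dvd_one.1 ((Nat.dvd_add_right (hpq.trans hqn)).1 hpm)) hp.one_lt.ne'
    · have := Nat.dvd_sub hpm (hpn p r hr hp hpr hpq)
      rw [show n + 1 - (n - 1) = 2 by omega] at this
      exact (Nat.prime_dvd_prime_iff_eq hp Nat.prime_two).1 this
end

section
/- Let d ≥ 1, let δ_1, …, δ_d be positive integers, let I be a nonempty subset of {1, …, d}, and let m be a positive integer such that δ_i divides m for every i ∈ I. Let x be a real number with |x| < 1. Then the family k ↦ x^{k_1 + ⋯ + k_d}, indexed by the set of k ∈ ℕ^d such that k_i ≥ 1 for all i, k_i δ_i = m for all i ∈ I, and k_j δ_j > m for all j ∉ I, is summable, and its sum equals x^{∑_{i=1}^d ⌊m/δ_i⌋} · (x/(1−x))^{d−|I|}. -/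
theorem summable_norm_and_hasSum_prod_pi {ι : Type*} :
    ∀ {n : ℕ} {f : Fin n → ι → ℝ} {a : Fin n → ℝ}, (∀ i, Summable fun k => ‖f i k‖) →
      (∀ i, HasSum (f i) (a i)) →
      (Summable fun k : Fin n → ι => ‖∏ i, f i (k i)‖) ∧
        HasSum (fun k : Fin n → ι => ∏ i, f i (k i)) (∏ i, a i) := by
  intro n
  induction n with
  | zero =>
    intro f a _ _
    refine ⟨(hasSum_fintype _).summable, ?_⟩
    convert hasSum_fintype (fun k : Fin 0 → ι => ∏ i, f i (k i)) using 1
    simp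
  | succ n ih =>
    intro f a hf ha
    obtain ⟨hs, ht⟩ := ih (fun i => hf i.succ) (fun i => ha i.succ)
    have hmul := summable_mul_of_summable_norm (hf 0) hs
    have hprod := HasSum.mul (ha 0) ht hmul
    have hnorm := (hf 0).mul_norm hs
    constructor
    · rw [← (Fin.consEquiv fun _ => ι).summable_iff]
      simpa [Function.comp_def, Fin.consEquiv, Fin.prod_univ_succ] using hnorm
    · rw [← (Fin.consEquiv fun _ => ι).hasSum_iff]
      simpa [Function.comp_def, Fin.consEquiv, Fin.prod_univ_succ] using hprod

theorem hasSum_ite_lt_geometric {x : ℝ} (hx : |x| < 1) (q : ℕ) :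
    HasSum (fun k : ℕ => if q < k then x ^ k else 0) (x ^ q * (x / (1 - x))) := by
  rw [← hasSum_nat_add_iff' (q + 1)]
  have hzero : ∑ k ∈ Finset.range (q + 1), (if q < k then x ^ k else 0) = 0 :=
    Finset.sum_eq_zero fun k hk => if_neg (by have := Finset.mem_range.mp hk; omega)
  have h := (hasSum_geometric_of_abs_lt_one hx).mul_left (x ^ (q + 1))
  rw [hzero, sub_zero]
  have hval : x ^ q * (x / (1 - x)) = x ^ (q + 1) * (1 - x)⁻¹ := by
    rw [div_eq_mul_inv, pow_succ, mul_assoc]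
  rw [hval]
  refine h.congr_fun fun k => ?_
  rw [if_pos (by omega), pow_add, mul_comm]

theorem stmt_17 (d : ℕ) (hd : 0 < d) (δ : Fin d → ℕ) (hδ : ∀ i, 0 < δ i)
    (I : Finset (Fin d)) (hI : I.Nonempty) (m : ℕ) (hm : 0 < m)
    (hdvd : ∀ i ∈ I, δ i ∣ m) (x : ℝ) (hx : |x| < 1) :
    HasSum
      (fun p : {k : Fin d → ℕ // (∀ i, 1 ≤ k i) ∧ (∀ i ∈ I, k i * δ i = m) ∧
          (∀ j ∉ I, m < k j * δ j)} => x ^ (∑ i, p.1 i))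
      (x ^ (∑ i, m / δ i) * (x / (1 - x)) ^ (d - I.card)) := by
  classical
  let P : Fin d → ℕ → Prop := fun i k => if i ∈ I then k = m / δ i else m / δ i < k
  let f : Fin d → ℕ → ℝ := fun i k => if P i k then x ^ k else 0
  let a : Fin d → ℝ := fun i => x ^ (m / δ i) * if i ∈ I then 1 else x / (1 - x)
  have hf (i : Fin d) : HasSum (f i) (a i) := by
    by_cases hi : i ∈ I
    · simp only [f, P, a, hi, if_true, mul_one]
      convert hasSum_ite_eq (m / δ i) (x ^ (m / δ i)) using 2 with k
      split_ifs with h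
      · rw [h]
      · rfl
    · simpa only [f, P, a, hi, if_false] using hasSum_ite_lt_geometric hx (m / δ i)
  have hprod := (summable_norm_and_hasSum_prod_pi (fun i => (hf i).summable.norm) hf).2
  have ha : ∏ i, a i = x ^ (∑ i, m / δ i) * (x / (1 - x)) ^ (d - I.card) := by
    simp only [a, Finset.prod_mul_distrib, Finset.prod_pow_eq_pow_sum]
    congr 1
    rw [Finset.prod_ite, Finset.prod_const_one, one_mul, Finset.prod_const,
      Finset.filter_not, Finset.filter_mem_eq_inter, Finset.univ_inter,
      Finset.card_sdiff_of_subset (Finset.subset_univ I), Finset.card_univ, Fintype.card_fin]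
  rw [ha] at hprod
  have hmem (k : Fin d → ℕ) : ((∀ i, 1 ≤ k i) ∧ (∀ i ∈ I, k i * δ i = m) ∧
      ∀ j ∉ I, m < k j * δ j) ↔ ∀ i, P i (k i) := by
    constructor
    · rintro ⟨-, h₁, h₂⟩ i
      by_cases hi : i ∈ I
      · simpa only [P, hi, if_true] using (Nat.div_eq_of_eq_mul_left (hδ i) (h₁ i hi).symm).symm
      · simpa only [P, hi, if_false] using (Nat.div_lt_iff_lt_mul (hδ i)).2 (h₂ i hi)
    · intro h
      have h₁ : ∀ i ∈ I, k i * δ i = m := fun i hi => by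
        have := h i
        simp only [P, hi, if_true] at this
        rw [this, Nat.div_mul_cancel (hdvd i hi)]
      have h₂ : ∀ j ∉ I, m < k j * δ j := fun j hj => by
        have := h j
        simp only [P, hj, if_false] at this
        exact (Nat.div_lt_iff_lt_mul (hδ j)).1 this
      refine ⟨fun i => ?_, h₁, h₂⟩
      refine Nat.pos_of_mul_pos_right (b := δ i) ?_
      by_cases hi : i ∈ I
      · exact (h₁ i hi).symm ▸ hm
      · exact hm.trans (h₂ i hi)
  refine (hasSum_subtype_iff_indicator (f := fun k : Fin d → ℕ => x ^ ∑ i, k i)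
    (s := {k | (∀ i, 1 ≤ k i) ∧ (∀ i ∈ I, k i * δ i = m) ∧ ∀ j ∉ I, m < k j * δ j})).2 ?_
  convert hprod using 1
  funext k
  simp only [f, Set.indicator_apply, Set.mem_ofPred_eq, hmem k]
  split_ifs with h
  · rw [← Finset.prod_pow_eq_pow_sum]
    exact Finset.prod_congr rfl fun i _ => (if_pos (h i)).symm
  · obtain ⟨i, hi⟩ := not_forall.mp h
    exact (Finset.prod_eq_zero (Finset.mem_univ i) (if_neg hi)).symm
end
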